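/- Let a₁, a₂ ∈ ℂ with a₁ − a₂ ∉ Λ_τ and a₁, a₂ ∉ S, let A ∈ ℂ, and assume c = ζ(a₁) + ζ(a₂). With φ_{a,c}(z) = c + ζ(z−a₁) + ζ(z−a₂) − ζ(z) − (1/2)(ζ(z+p) + ζ(z−p)) and g = φ_{a,c}' + φ_{a,c}² − q(·;A), the function g has at most a simple pole at z = a₁, with residue equal to (℘'(a₁)(℘(p) − ℘(a₂)) + ℘'(a₂)(℘(p) − ℘(a₁))) / ((℘(p) − ℘(a₁))(℘(a₁) − ℘(a₂))). -/

import Mathlib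

open Complex Filter Topology

noncomputable section

/-- The lattice `Λ_τ = ℤ + τℤ`. -/
def Lam (τ : ℂ) : Set ℂ := {ω | ∃ m n : ℤ, ω = (m : ℂ) + (n : ℂ) * τ}

/-- The nonzero lattice points. -/
def Lam' (τ : ℂ) : Set ℂ := {ω | ω ∈ Lam τ ∧ ω ≠ 0}

/-- The Weierstrass elliptic function `℘(z; τ)`. -/
def wp (τ z : ℂ) : ℂ :=
  1 / z ^ 2 + ∑' ω : Lam' τ, (1 / (z - (ω : ℂ)) ^ 2 - 1 / (ω : ℂ) ^ 2)

/-- The Weierstrass zeta function `ζ(z; τ)`. -/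
def wzeta (τ z : ℂ) : ℂ :=
  1 / z + ∑' ω : Lam' τ, (1 / (z - (ω : ℂ)) + 1 / (ω : ℂ) + z / (ω : ℂ) ^ 2)

/-- The Weierstrass sigma function `σ(z; τ)`. -/
def wsigma (τ z : ℂ) : ℂ :=
  z * ∏' ω : Lam' τ,
    ((1 - z / (ω : ℂ)) * Complex.exp (z / (ω : ℂ) + z ^ 2 / (2 * (ω : ℂ) ^ 2)))

/-- `℘'(z; τ)`. -/
def wpd (τ : ℂ) : ℂ → ℂ := deriv (wp τ)

/-- `℘''(z; τ)`. -/
def wpdd (τ : ℂ) : ℂ → ℂ := deriv (deriv (wp τ))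

/-- The constant `B(A)`. -/
def Bc (τ p A : ℂ) : ℂ :=
  A ^ 2 - wzeta τ (2 * p) * A - 3 / 4 * wp τ (2 * p) - 2 * wp τ p

/-- The potential `q(z; A)`. -/
def qpot (τ p A z : ℂ) : ℂ :=
  2 * wp τ z + 3 / 4 * (wp τ (z + p) + wp τ (z - p))
    + A * (wzeta τ (z + p) - wzeta τ (z - p)) + Bc τ p A

/-- The singular set `S = Λ_τ ∪ (p + Λ_τ) ∪ (−p + Λ_τ)`. -/
def Sset (τ p : ℂ) : Set ℂ :=
  Lam τ ∪ {z | z - p ∈ Lam τ} ∪ {z | z + p ∈ Lam τ}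

/-- The unique elliptic solution `Φ_e(z; A)` of the second symmetric product equation. -/
def Phie (τ p A z : ℂ) : ℂ :=
  wp τ z + (A / 2 - 3 * wpdd τ p / (8 * wpd τ p)) * (wzeta τ (z + p) - wzeta τ (z - p))
    - A ^ 2 + (wpdd τ p / (2 * wpd τ p) - wzeta τ p) * A
    - wp τ p + 3 / 4 * (wpdd τ p / wpd τ p) * wzeta τ p
    + 3 / 16 * (wpdd τ p ^ 2 / wpd τ p ^ 2)

/-- The cubic factor `Y₁(A)`. -/
def Y1 (τ p A : ℂ) : ℂ :=
  A ^ 3 - 5 * wpdd τ p / (4 * wpd τ p) * A ^ 2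
    + 3 * (wp τ p + wpdd τ p ^ 2 / (16 * wpd τ p ^ 2)) * A
    + wpd τ p / 2 - 9 * wpdd τ p / (4 * wpd τ p) * wp τ p
    + 9 / 64 * (wpdd τ p ^ 3 / wpd τ p ^ 3)

/-- The cubic factor `Y₂(A)`. -/
def Y2 (τ p A : ℂ) : ℂ :=
  A ^ 3 - wpdd τ p / (4 * wpd τ p) * A ^ 2
    - 5 / 16 * (wpdd τ p ^ 2 / wpd τ p ^ 2) * A
    + 2 * wpd τ p - 3 / 64 * (wpdd τ p ^ 3 / wpd τ p ^ 3)

/-- The logarithmic derivative `φ_{a,c} = y_{a,c}'/y_{a,c}`. -/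
def phiac (τ p a₁ a₂ c z : ℂ) : ℂ :=
  c + wzeta τ (z - a₁) + wzeta τ (z - a₂) - wzeta τ z
    - 1 / 2 * (wzeta τ (z + p) + wzeta τ (z - p))

/-- The error function `g = φ_{a,c}' + φ_{a,c}² − q(·;A)`. -/
def gfun (τ p a₁ a₂ c A z : ℂ) : ℂ :=
  deriv (phiac τ p a₁ a₂ c) z + (phiac τ p a₁ a₂ c z) ^ 2 - qpot τ p A z

namespace PeriodPair

variable (L : PeriodPair)

lemma norm_weierstrassZeta_summand_le {r : ℝ} (hr : 0 < r) {s l : ℂ} (hs : ‖s‖ < r)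
    (h : 2 * r ≤ ‖l‖) :
    ‖1 / (s - l) + 1 / l + s / l ^ 2‖ ≤ 2 * r ^ 2 * ‖l‖ ^ (-3 : ℝ) := by
  have hl : 0 < ‖l‖ := by linarith
  have hl0 : l ≠ 0 := norm_pos_iff.mp hl
  have hsl : s - l ≠ 0 := by
    rw [sub_ne_zero]
    rintro rfl
    linarith
  have hle : ‖l‖ / 2 ≤ ‖s - l‖ := by
    rw [norm_sub_rev]
    exact .trans (by linarith) (norm_sub_norm_le l s)
  calc
    _ = ‖s ^ 2 / ((s - l) * l ^ 2)‖ := by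
      congr 1
      field
    _ = ‖s‖ ^ 2 / (‖s - l‖ * ‖l‖ ^ 2) := by simp
    _ ≤ r ^ 2 / (‖l‖ / 2 * ‖l‖ ^ 2) := by gcongr
    _ = 2 * r ^ 2 / ‖l‖ ^ 3 := by field
    _ = _ := by norm_cast

/-- The Weierstrass `ζ`-function with its singular term `1 / z` at the origin removed. -/
def weierstrassZetaRegular (z : ℂ) : ℂ :=
  ∑' l : L.lattice, if l.1 = 0 then 0 else (1 / (z - l) + 1 / l + z / l ^ 2)

/-- The Weierstrass `ζ`-function attached to a pair of periods. -/
def weierstrassZeta (z : ℂ) : ℂ := 1 / z + L.weierstrassZetaRegular z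

lemma hasSumLocallyUniformly_weierstrassZetaRegular :
    HasSumLocallyUniformly
      (fun (l : L.lattice) (z : ℂ) ↦ if l.1 = 0 then 0 else (1 / (z - l) + 1 / l + z / l ^ 2))
      L.weierstrassZetaRegular := by
  refine L.hasSumLocallyUniformly_aux (u := (2 * · ^ 2 * ‖·‖ ^ (-3 : ℝ))) _
    (fun _ _ ↦ (ZLattice.summable_norm_rpow _ _ (by simp; norm_num)).mul_left _) fun r hr ↦
    Filter.eventually_atTop.mpr ⟨2 * r, ?_⟩
  rintro _ h s hs l rfl
  split_ifs
  · simpa using! show 0 ≤ 2 * r ^ 2 * (‖↑l‖ ^ 3)⁻¹ by positivity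
  · exact norm_weierstrassZeta_summand_le hr hs h

lemma hasDerivAt_weierstrassZeta_summand {z l : ℂ} (h : z - l ≠ 0) :
    HasDerivAt (fun z ↦ 1 / (z - l) + 1 / l + z / l ^ 2) (-(1 / (z - l) ^ 2 - 1 / l ^ 2)) z := by
  have h1 := (((hasDerivAt_id z).sub_const l).inv h).add_const (1 / l)
  have h2 := h1.add ((hasDerivAt_id z).div_const (l ^ 2))
  convert! h2 using 1
  · ext w; simp
  · simp only [id]; ring

lemma sub_ne_zero_of_mem_compl_diff {z : ℂ} (hz : z ∈ ((L.lattice : Set ℂ) \ {0})ᶜ)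
    {l : L.lattice} (hl : l.1 ≠ 0) : z - l ≠ 0 := by
  rw [sub_ne_zero]
  rintro rfl
  simp_all

lemma differentiableOn_weierstrassZetaRegular :
    DifferentiableOn ℂ L.weierstrassZetaRegular ((L.lattice : Set ℂ) \ {0})ᶜ := by
  refine L.hasSumLocallyUniformly_weierstrassZetaRegular.hasSumLocallyUniformlyOn.differentiableOn
    (.of_forall fun s ↦ .fun_sum fun l _ ↦ ?_) L.isOpen_compl_lattice_sdiff
  split_ifs with hl
  · simp
  · exact fun z hz ↦ (hasDerivAt_weierstrassZeta_summand
      (L.sub_ne_zero_of_mem_compl_diff hz hl)).differentiableAt.differentiableWithinAt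

lemma deriv_weierstrassZetaRegular {z : ℂ} (hz : z ∈ ((L.lattice : Set ℂ) \ {0})ᶜ) :
    deriv L.weierstrassZetaRegular z = -℘[L - (0 : ℂ)] z := by
  have key : Set.EqOn (deriv L.weierstrassZetaRegular) (fun z ↦ -℘[L - (0 : ℂ)] z)
      ((L.lattice : Set ℂ) \ {0})ᶜ := by
    refine (L.hasSumLocallyUniformly_weierstrassZetaRegular.tendstoLocallyUniformlyOn.deriv
      (.of_forall fun s ↦ .fun_sum fun l _ ↦ ?_) L.isOpen_compl_lattice_sdiff).unique ?_
    · split_ifs with hl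
      · simp
      · exact fun z hz ↦ (hasDerivAt_weierstrassZeta_summand
          (L.sub_ne_zero_of_mem_compl_diff hz hl)).differentiableAt.differentiableWithinAt
    · refine (L.hasSumLocallyUniformly_weierstrassPExcept 0).tendstoLocallyUniformlyOn.neg.congr ?_
      intro s z hz
      simp only [Function.comp_apply, Pi.neg_apply]
      rw [← Finset.sum_neg_distrib]
      refine (HasDerivAt.fun_sum fun l _ ↦ ?_).deriv.symm
      split_ifs with hl
      · simpa using hasDerivAt_const z (0 : ℂ)
      · exact hasDerivAt_weierstrassZeta_summand (L.sub_ne_zero_of_mem_compl_diff hz hl)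
  exact key hz

lemma analyticAt_weierstrassZetaRegular : AnalyticAt ℂ L.weierstrassZetaRegular 0 :=
  L.differentiableOn_weierstrassZetaRegular.analyticAt (L.compl_lattice_sdiff_singleton_mem_nhds 0)

lemma weierstrassZetaRegular_neg (z : ℂ) :
    L.weierstrassZetaRegular (-z) = -L.weierstrassZetaRegular z := by
  simp only [weierstrassZetaRegular]
  rw [← (Equiv.neg L.lattice).tsum_eq, ← tsum_neg]
  congr! 2 with l
  by_cases hl : l = 0
  · simp [hl]
  · have : (-z + l : ℂ) = -(z - l) := by ring
    simp [hl, this, -neg_sub, div_neg]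
    ring

@[simp] lemma weierstrassZetaRegular_zero : L.weierstrassZetaRegular 0 = 0 := by
  simpa [CharZero.eq_neg_self_iff] using L.weierstrassZetaRegular_neg 0

@[simp] lemma weierstrassZeta_neg (z : ℂ) : L.weierstrassZeta (-z) = -L.weierstrassZeta z := by
  rw [weierstrassZeta, weierstrassZeta, weierstrassZetaRegular_neg, div_neg]
  ring

lemma weierstrassP_eq_except_zero (z : ℂ) : ℘[L] z = 1 / z ^ 2 + ℘[L - (0 : ℂ)] z := by
  have := L.weierstrassPExcept_add 0 z
  simp at this
  rw [← this]
  simp [add_comm]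

lemma hasDerivAt_weierstrassZeta {z : ℂ} (hz : z ∉ L.lattice) :
    HasDerivAt L.weierstrassZeta (-℘[L] z) z := by
  have hz0 : z ≠ 0 := by rintro rfl; simp at hz
  have hz' : z ∈ ((L.lattice : Set ℂ) \ {0})ᶜ := by simp [hz]
  have h1 := ((L.differentiableOn_weierstrassZetaRegular).differentiableAt
    (L.isOpen_compl_lattice_sdiff.mem_nhds hz')).hasDerivAt
  rw [L.deriv_weierstrassZetaRegular hz'] at h1
  convert! (hasDerivAt_inv hz0).add h1 using 1
  · ext w; simp [weierstrassZeta]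
  · rw [weierstrassP_eq_except_zero]; ring

lemma isPreconnected_compl_lattice : IsPreconnected (L.lattice : Set ℂ)ᶜ := by
  have hc : (L.lattice : Set ℂ).Countable := by
    have : Countable L.lattice := L.latticeEquivProd.toEquiv.countable_iff.mpr inferInstance
    exact Set.to_countable _
  exact (hc.isConnected_compl_of_one_lt_rank (by simp [Complex.rank_real_complex])).isPreconnected

lemma analyticAt_weierstrassZeta {z : ℂ} (hz : z ∉ L.lattice) :
    AnalyticAt ℂ L.weierstrassZeta z := by
  have : DifferentiableOn ℂ L.weierstrassZeta (L.lattice : Set ℂ)ᶜ := fun w hw ↦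
    (L.hasDerivAt_weierstrassZeta hw).differentiableAt.differentiableWithinAt
  exact this.analyticAt (L.isClosed_lattice.isOpen_compl.mem_nhds hz)

lemma analyticAt_weierstrassP {z : ℂ} (hz : z ∉ L.lattice) : AnalyticAt ℂ ℘[L] z :=
  L.analyticOnNhd_weierstrassP z hz

lemma analyticAt_derivWeierstrassP {z : ℂ} (hz : z ∉ L.lattice) : AnalyticAt ℂ ℘'[L] z :=
  L.analyticOnNhd_derivWeierstrassP z hz

lemma exists_weierstrassZeta_add (l : L.lattice) :
    ∃ η, ∀ z ∉ L.lattice, L.weierstrassZeta (z + l) = L.weierstrassZeta z + η := by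
  have hd : ∀ z ∈ (L.lattice : Set ℂ)ᶜ,
      HasDerivAt (fun z ↦ L.weierstrassZeta (z + l) - L.weierstrassZeta z) 0 z := by
    intro z hz
    have hzl : z + l ∉ L.lattice := by
      rwa [L.lattice.add_mem_iff_left l.2]
    have := ((L.hasDerivAt_weierstrassZeta hzl).comp_add_const z l).sub
      (L.hasDerivAt_weierstrassZeta hz)
    simpa using! this
  obtain ⟨η, hη⟩ := L.isClosed_lattice.isOpen_compl.exists_is_const_of_deriv_eq_zero
    L.isPreconnected_compl_lattice
    (fun z hz ↦ (hd z hz).differentiableAt.differentiableWithinAt) (fun z hz ↦ (hd z hz).deriv)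
  exact ⟨η, fun z hz ↦ by rw [← hη z hz]; ring⟩

end PeriodPair

lemma tendsto_add_const_nhdsNE (x c : ℂ) :
    Tendsto (fun z ↦ z + c) (𝓝[≠] x) (𝓝[≠] (x + c)) := by
  refine tendsto_nhdsWithin_iff.mpr ⟨?_, ?_⟩
  · exact ((continuous_id.add continuous_const).tendsto x).mono_left nhdsWithin_le_nhds
  · filter_upwards [self_mem_nhdsWithin] with z hz
    simpa using hz

/-- `f` agrees near `x`, away from `x` itself, with a function that is analytic at `x`. -/
def ExtendsAnalyticallyAt (f : ℂ → ℂ) (x : ℂ) : Prop :=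
  ∃ g, AnalyticAt ℂ g x ∧ f =ᶠ[𝓝[≠] x] g

namespace ExtendsAnalyticallyAt

variable {f g : ℂ → ℂ} {x : ℂ}

lemma of_analyticAt (hf : AnalyticAt ℂ f x) : ExtendsAnalyticallyAt f x := ⟨f, hf, .rfl⟩

lemma add (hf : ExtendsAnalyticallyAt f x) (hg : ExtendsAnalyticallyAt g x) :
    ExtendsAnalyticallyAt (f + g) x := by
  obtain ⟨F, hF, hfF⟩ := hf
  obtain ⟨G, hG, hgG⟩ := hg
  exact ⟨F + G, hF.add hG, hfF.add hgG⟩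

lemma congr (hf : ExtendsAnalyticallyAt f x) (h : f =ᶠ[𝓝[≠] x] g) :
    ExtendsAnalyticallyAt g x := by
  obtain ⟨F, hF, hfF⟩ := hf
  exact ⟨F, hF, h.symm.trans hfF⟩

lemma translate {l : ℂ} (hl : ∀ᶠ z in 𝓝[≠] x, f (z + l) = f z)
    (hf : ExtendsAnalyticallyAt f x) : ExtendsAnalyticallyAt f (x + l) := by
  obtain ⟨F, hF, hfF⟩ := hf
  refine ⟨fun z ↦ F (z - l), ?_, ?_⟩
  · refine AnalyticAt.comp (g := F) (f := fun z ↦ z - l) ?_ (by fun_prop)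
    simpa using hF
  · have ht : Tendsto (fun z ↦ z - l) (𝓝[≠] (x + l)) (𝓝[≠] x) := by
      simpa [← sub_eq_add_neg] using tendsto_add_const_nhdsNE (x + l) (-l)
    filter_upwards [ht.eventually hfF, ht.eventually hl] with z hz hlz
    rw [← hz, ← hlz, sub_add_cancel]

lemma limUnder_eventuallyEq {F : ℂ → ℂ} (hF : AnalyticAt ℂ F x) (hfF : f =ᶠ[𝓝[≠] x] F) :
    (fun y ↦ limUnder (𝓝[≠] y) f) =ᶠ[𝓝 x] F := by
  have h : ∀ᶠ y in 𝓝 x, f =ᶠ[𝓝[≠] y] F := by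
    have h1 : ∀ᶠ y in 𝓝[≠] x, f =ᶠ[𝓝[≠] y] F := by
      have := eventually_eventually_nhdsWithin.mpr hfF
      filter_upwards [this, self_mem_nhdsWithin] with y hy hyx
      rw [isOpen_compl_singleton.nhdsWithin_eq hyx] at hy
      exact hy.filter_mono nhdsWithin_le_nhds
    rw [eventually_nhdsWithin_iff] at h1
    filter_upwards [h1] with y hy
    by_cases hyx : y = x
    · exact hyx ▸ hfF
    · exact hy hyx
  filter_upwards [h, hF.eventually_analyticAt] with y hy hFy
  exact ((hFy.continuousAt.tendsto.mono_left nhdsWithin_le_nhds).congr' hy.symm).limUnder_eq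

end ExtendsAnalyticallyAt

lemma exists_analyticAt_eq_sub_mul {f : ℂ → ℂ} {x : ℂ} (hf : AnalyticAt ℂ f x) (h0 : f x = 0) :
    ∃ g, AnalyticAt ℂ g x ∧ ∀ᶠ z in 𝓝 x, f z = (z - x) * g z := by
  have : ((1 : ℕ) : ℕ∞) ≤ analyticOrderAt f x :=
    (natCast_le_analyticOrderAt_iff_iteratedDeriv_eq_zero hf).mpr (by simpa using h0)
  simpa using (natCast_le_analyticOrderAt hf).mp this

lemma exists_analyticAt_eq_sub_sq_mul {f : ℂ → ℂ} {x : ℂ} (hf : AnalyticAt ℂ f x) (h0 : f x = 0)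
    (h1 : deriv f x = 0) :
    ∃ g, AnalyticAt ℂ g x ∧ ∀ᶠ z in 𝓝 x, f z = (z - x) ^ 2 * g z := by
  have : ((2 : ℕ) : ℕ∞) ≤ analyticOrderAt f x :=
    (natCast_le_analyticOrderAt_iff_iteratedDeriv_eq_zero hf).mpr fun i hi ↦ by
      interval_cases i <;> simpa
  simpa using (natCast_le_analyticOrderAt hf).mp this

namespace PeriodPair

variable (L : PeriodPair)

/-- **Liouville's theorem** for elliptic functions all of whose singularities are removable. -/
lemma exists_eq_const_of_periodic {f : ℂ → ℂ}
    (hper : ∀ l : L.lattice, ∀ x, ∀ᶠ z in 𝓝[≠] x, f (z + l) = f z)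
    (hext : ∀ x, ExtendsAnalyticallyAt f x) : ∃ C, ∀ x, ContinuousAt f x → f x = C := by
  set N : ℂ → ℂ := fun y ↦ limUnder (𝓝[≠] y) f with hN
  have hNf : ∀ x, AnalyticAt ℂ N x ∧ f =ᶠ[𝓝[≠] x] N := fun x ↦ by
    obtain ⟨F, hF, hfF⟩ := hext x
    have := ExtendsAnalyticallyAt.limUnder_eventuallyEq hF hfF
    exact ⟨hF.congr this.symm, hfF.trans (this.symm.filter_mono nhdsWithin_le_nhds)⟩
  have hdiff : Differentiable ℂ N := fun x ↦ (hNf x).1.differentiableAt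
  have hNper : ∀ z w, w ∈ L.lattice → N (z + w) = N z := by
    intro z w hw
    obtain ⟨-, h1⟩ := hNf z
    have hc : Tendsto (fun y ↦ N (y + w)) (𝓝[≠] z) (𝓝 (N (z + w))) :=
      ((hdiff.continuous.comp (continuous_id.add continuous_const)).tendsto z).mono_left
        nhdsWithin_le_nhds
    refine tendsto_nhds_unique (hc.congr' ?_)
      ((hdiff.continuous.tendsto z).mono_left nhdsWithin_le_nhds)
    filter_upwards [h1, (tendsto_add_const_nhdsNE z w).eventually (hNf (z + w)).2,
      hper ⟨w, hw⟩ z] with y hy hyw hp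
    rw [← hy, ← hyw, hp]
  refine ⟨N 0, fun x hx ↦ ?_⟩
  rw [← hdiff.apply_eq_apply_of_bounded (IsZLattice.isCompact_range_of_periodic L.lattice _
    hdiff.continuous hNper).isBounded x 0]
  exact tendsto_nhds_unique ((hx.tendsto.mono_left nhdsWithin_le_nhds).congr' (hNf x).2)
    ((hdiff.continuous.tendsto x).mono_left nhdsWithin_le_nhds)

end PeriodPair

namespace PeriodPair

variable (L : PeriodPair)

lemma analyticAt_weierstrassZeta_add {z c : ℂ} (h : z + c ∉ L.lattice) :
    AnalyticAt ℂ (fun w ↦ L.weierstrassZeta (w + c)) z :=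
  AnalyticAt.comp (g := L.weierstrassZeta) (f := fun w ↦ w + c)
    (L.analyticAt_weierstrassZeta h) (by fun_prop)

lemma analyticAt_weierstrassZeta_sub {z c : ℂ} (h : z - c ∉ L.lattice) :
    AnalyticAt ℂ (fun w ↦ L.weierstrassZeta (w - c)) z := by
  simpa only [sub_eq_add_neg] using
    L.analyticAt_weierstrassZeta_add (c := -c) (by simpa only [← sub_eq_add_neg] using h)

lemma eventually_add_notMem_lattice (c x : ℂ) : ∀ᶠ z in 𝓝[≠] x, z + c ∉ L.lattice := by
  have ht : Tendsto (fun z ↦ z + c) (𝓝 x) (𝓝 (x + c)) :=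
    (continuous_id.add continuous_const).tendsto x
  rw [eventually_nhdsWithin_iff]
  filter_upwards [ht.eventually (L.compl_lattice_sdiff_singleton_mem_nhds (x + c))] with z hz hzx
  simpa [show z ≠ x from hzx] using hz

lemma exists_weierstrassZeta_eq_inv_add {l : ℂ} (hl : l ∈ L.lattice) :
    ∃ e, AnalyticAt ℂ e l ∧ ∀ᶠ z in 𝓝[≠] l, L.weierstrassZeta z = 1 / (z - l) + e z := by
  obtain ⟨η, hη⟩ := L.exists_weierstrassZeta_add ⟨l, hl⟩
  refine ⟨fun z ↦ L.weierstrassZetaRegular (z - l) + η, ?_, ?_⟩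
  · refine AnalyticAt.add (AnalyticAt.comp (g := L.weierstrassZetaRegular) (f := fun z ↦ z - l)
      ?_ (by fun_prop)) analyticAt_const
    simpa using L.analyticAt_weierstrassZetaRegular
  · filter_upwards [L.eventually_add_notMem_lattice (-l) l] with z hz
    rw [← sub_eq_add_neg] at hz
    have := hη _ hz
    simp only [sub_add_cancel] at this
    rw [this, weierstrassZeta]
    ring

/-- The simple poles of `ζ(z + b)` are cancelled by the zeros of `℘(z) - ℘(b)`. -/
lemma extendsAnalyticallyAt_weierstrassZeta_mul (b : ℂ) {x : ℂ} (hx : x ∉ L.lattice) :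
    ExtendsAnalyticallyAt (fun z ↦ L.weierstrassZeta (z + b) * (℘[L] z - ℘[L] b)) x := by
  have hP : AnalyticAt ℂ (fun z ↦ ℘[L] z - ℘[L] b) x :=
    (L.analyticAt_weierstrassP hx).sub analyticAt_const
  by_cases hxb : x + b ∈ L.lattice
  · obtain ⟨e, he, hze⟩ := L.exists_weierstrassZeta_eq_inv_add hxb
    have hPx : ℘[L] x - ℘[L] b = 0 := by
      have := L.weierstrassP_add_coe (-b) ⟨_, hxb⟩
      simp only [weierstrassP_neg] at this
      rw [← this]
      simp
    obtain ⟨g, hg, hPg⟩ := exists_analyticAt_eq_sub_mul hP hPx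
    refine ⟨fun z ↦ g z + e (z + b) * (℘[L] z - ℘[L] b), hg.add (AnalyticAt.mul
      (AnalyticAt.comp (g := e) (f := fun z ↦ z + b) he (by fun_prop)) hP), ?_⟩
    filter_upwards [(tendsto_add_const_nhdsNE x b).eventually hze, hPg.filter_mono nhdsWithin_le_nhds,
      self_mem_nhdsWithin] with z hz hgz hzx
    have : z - x ≠ 0 := sub_ne_zero.mpr hzx
    rw [hz, add_mul, add_sub_add_right_eq_sub, one_div]
    congr 1
    rw [hgz]
    field_simp
  · exact .of_analyticAt (AnalyticAt.mul (L.analyticAt_weierstrassZeta_add hxb) hP)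

/-- The difference of the two sides of the addition formula for `ζ`. -/
def zetaAdditionDefect (b z : ℂ) : ℂ :=
  (L.weierstrassZeta (z + b) + L.weierstrassZeta (z - b) - 2 * L.weierstrassZeta z) *
    (℘[L] z - ℘[L] b) - ℘'[L] z

lemma extendsAnalyticallyAt_zetaAdditionDefect_zero {b : ℂ} (hb : b ∉ L.lattice) :
    ExtendsAnalyticallyAt (L.zetaAdditionDefect b) 0 := by
  have hb' : -b ∉ L.lattice := by simpa using hb
  set E := L.weierstrassZetaRegular
  set P := ℘[L - (0 : ℂ)]
  have hE : AnalyticAt ℂ E 0 := L.analyticAt_weierstrassZetaRegular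
  have hP : AnalyticAt ℂ P 0 := L.analyticAt_weierstrassPExcept 0
  have hP0 : P 0 = 0 := L.weierstrassPExcept_zero 0
  obtain ⟨e, he, hEe⟩ := exists_analyticAt_eq_sub_sq_mul hE L.weierstrassZetaRegular_zero
    (by rw [L.deriv_weierstrassZetaRegular (by simp)]; simp)
  obtain ⟨q, hq, hPq⟩ := exists_analyticAt_eq_sub_mul hP hP0
  set S : ℂ → ℂ := fun z ↦ L.weierstrassZeta (z + b) + L.weierstrassZeta (z - b) with hSdef
  have hS : AnalyticAt ℂ S 0 := by
    refine AnalyticAt.add (L.analyticAt_weierstrassZeta_add (by simpa using hb))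
      (L.analyticAt_weierstrassZeta_sub (by simpa using hb))
  have hSd : HasDerivAt S (-℘[L] b + -℘[L] b) 0 := by
    have h1 : HasDerivAt L.weierstrassZeta (-℘[L] b) (0 + b) := by
      simpa using L.hasDerivAt_weierstrassZeta hb
    have h2 : HasDerivAt L.weierstrassZeta (-℘[L] b) (0 - b) := by
      simpa using L.hasDerivAt_weierstrassZeta hb'
    exact (h1.comp_add_const 0 b).add (h2.comp_sub_const 0 b)
  obtain ⟨k, hk, hSk⟩ := exists_analyticAt_eq_sub_sq_mul (f := fun z ↦ S z + 2 * ℘[L] b * z)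
    (x := 0) (by fun_prop) (by simp [hSdef]) (by
      refine (hSd.add ((hasDerivAt_id (0 : ℂ)).const_mul (2 * ℘[L] b))).deriv.trans ?_
      ring)
  refine ⟨fun z ↦ k z + S z * (P z - ℘[L] b) - 2 * q z - 2 * e z - 2 * E z * (P z - ℘[L] b) -
    ℘'[L - (0 : ℂ)] z, ?_, ?_⟩
  · have := L.analyticAt_derivWeierstrassPExcept 0
    fun_prop
  · filter_upwards [hEe.filter_mono nhdsWithin_le_nhds, hPq.filter_mono nhdsWithin_le_nhds,
      hSk.filter_mono nhdsWithin_le_nhds, self_mem_nhdsWithin] with z hEz hPz hSz hz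
    have hz : z ≠ 0 := hz
    have hd : ℘'[L] z = ℘'[L - (0 : ℂ)] z - 2 / z ^ 3 := by
      simpa using (L.derivWeierstrassPExcept_sub 0 z).symm
    have hp : ℘[L] z = 1 / z ^ 2 + P z := L.weierstrassP_eq_except_zero z
    have hζ : L.weierstrassZeta z = 1 / z + E z := rfl
    have hSz' : S z = z ^ 2 * k z - 2 * ℘[L] b * z := by
      simp only [sub_zero] at hSz
      linear_combination hSz
    simp only [sub_zero] at hEz hPz
    change (S z - 2 * L.weierstrassZeta z) * (℘[L] z - ℘[L] b) - ℘'[L] z = _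
    rw [hd, hp, hζ, hSz', hEz, hPz]
    field_simp
    ring

lemma extendsAnalyticallyAt_zetaAdditionDefect_of_notMem (b : ℂ) {x : ℂ} (hx : x ∉ L.lattice) :
    ExtendsAnalyticallyAt (L.zetaAdditionDefect b) x := by
  have h1 := L.extendsAnalyticallyAt_weierstrassZeta_mul b hx
  have h2 := L.extendsAnalyticallyAt_weierstrassZeta_mul (-b) hx
  have h3 : AnalyticAt ℂ (fun z ↦ -2 * L.weierstrassZeta z * (℘[L] z - ℘[L] b) - ℘'[L] z) x := by
    have := L.analyticAt_weierstrassZeta hx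
    have := L.analyticAt_weierstrassP hx
    have := L.analyticAt_derivWeierstrassP hx
    fun_prop
  refine ((h1.add h2).add (.of_analyticAt h3)).congr (.of_forall fun z ↦ ?_)
  simp only [Pi.add_apply, zetaAdditionDefect, weierstrassP_neg, ← sub_eq_add_neg]
  ring

lemma zetaAdditionDefect_add_coe (b x : ℂ) (l : L.lattice) :
    ∀ᶠ z in 𝓝[≠] x, L.zetaAdditionDefect b (z + l) = L.zetaAdditionDefect b z := by
  obtain ⟨η, hη⟩ := L.exists_weierstrassZeta_add l
  filter_upwards [L.eventually_add_notMem_lattice b x, L.eventually_add_notMem_lattice (-b) x,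
    L.eventually_add_notMem_lattice 0 x] with z h1 h2 h3
  rw [← sub_eq_add_neg] at h2
  rw [add_zero] at h3
  simp only [zetaAdditionDefect, weierstrassP_add_coe, derivWeierstrassP_add_coe]
  rw [add_right_comm z, add_sub_right_comm z, hη _ h1, hη _ h2, hη _ h3]
  ring

lemma zetaAdditionDefect_neg (b z : ℂ) :
    L.zetaAdditionDefect b (-z) = -L.zetaAdditionDefect b z := by
  have h1 : -z + b = -(z - b) := by ring
  have h2 : -z - b = -(z + b) := by ring
  simp only [zetaAdditionDefect, h1, h2, weierstrassZeta_neg, weierstrassP_neg,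
    derivWeierstrassP_neg]
  ring

/-- A form of the **addition formula** for the Weierstrass `ζ`-function. -/
lemma weierstrassZeta_add_add_weierstrassZeta_sub {z b : ℂ} (hz : z ∉ L.lattice)
    (hb : b ∉ L.lattice) (hadd : z + b ∉ L.lattice) (hsub : z - b ∉ L.lattice) :
    (L.weierstrassZeta (z + b) + L.weierstrassZeta (z - b) - 2 * L.weierstrassZeta z) *
      (℘[L] z - ℘[L] b) = ℘'[L] z := by
  have hext : ∀ x, ExtendsAnalyticallyAt (L.zetaAdditionDefect b) x := fun x ↦ by
    by_cases hx : x ∈ L.lattice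
    · simpa using (L.extendsAnalyticallyAt_zetaAdditionDefect_zero hb).translate
        (L.zetaAdditionDefect_add_coe b 0 ⟨x, hx⟩)
    · exact L.extendsAnalyticallyAt_zetaAdditionDefect_of_notMem b hx
  obtain ⟨C, hC⟩ := L.exists_eq_const_of_periodic
    (fun l x ↦ L.zetaAdditionDefect_add_coe b x l) hext
  have hcont : ∀ w, w ∉ L.lattice → w + b ∉ L.lattice → w - b ∉ L.lattice →
      ContinuousAt (L.zetaAdditionDefect b) w := by
    intro w h1 h2 h3
    have a1 := L.analyticAt_weierstrassZeta h1
    have a2 : AnalyticAt ℂ (fun w ↦ L.weierstrassZeta (w + b)) w :=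
      L.analyticAt_weierstrassZeta_add h2
    have a3 : AnalyticAt ℂ (fun w ↦ L.weierstrassZeta (w - b)) w :=
      L.analyticAt_weierstrassZeta_sub h3
    have a4 := L.analyticAt_weierstrassP h1
    have a5 := L.analyticAt_derivWeierstrassP h1
    unfold zetaAdditionDefect
    exact AnalyticAt.continuousAt (𝕜 := ℂ) (by fun_prop)
  have e1 := hC z (hcont z hz hadd hsub)
  have e2 := hC (-z) (hcont (-z) (by simpa using hz)
    (by rw [← L.lattice.neg_mem_iff]; convert! hsub using 2; ring)
    (by rw [← L.lattice.neg_mem_iff]; convert! hadd using 2; ring))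
  rw [zetaAdditionDefect_neg] at e2
  have : L.zetaAdditionDefect b z = 0 := by linear_combination (e1 - e2) / 2
  exact sub_eq_zero.mp this

lemma not_eventually_weierstrassP_eq (c : ℂ) {x : ℂ} (hx : x ∉ L.lattice) :
    ¬ ∀ᶠ z in 𝓝 x, ℘[L] z = c := by
  intro h
  have heq : Set.EqOn ℘[L] (fun _ ↦ c) (L.lattice : Set ℂ)ᶜ :=
    AnalyticOnNhd.eqOn_of_preconnected_of_eventuallyEq L.analyticOnNhd_weierstrassP
      (fun _ _ ↦ analyticAt_const) L.isPreconnected_compl_lattice hx h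
  have hcont : ContinuousAt (fun z ↦ z ^ 2 * (c - ℘[L - (0 : ℂ)] z)) 0 :=
    have := (L.analyticAt_weierstrassPExcept 0).continuousAt
    by fun_prop
  have hlim : Tendsto (fun z ↦ z ^ 2 * (c - ℘[L - (0 : ℂ)] z)) (𝓝[≠] 0) (𝓝 0) := by
    simpa using hcont.tendsto.mono_left nhdsWithin_le_nhds
  refine one_ne_zero (tendsto_nhds_unique ((tendsto_const_nhds (x := (1 : ℂ))).congr' ?_) hlim)
  filter_upwards [L.eventually_add_notMem_lattice 0 0, self_mem_nhdsWithin] with z hz hz0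
  have hz0 : z ≠ 0 := hz0
  rw [add_zero] at hz
  have h1 : ℘[L] z = c := heq hz
  rw [← h1, weierstrassP_eq_except_zero]
  field_simp
  ring

lemma weierstrassP_ne_weierstrassP {z b : ℂ} (hz : z ∉ L.lattice)
    (hb : b ∉ L.lattice) (hadd : z + b ∉ L.lattice) (hsub : z - b ∉ L.lattice) :
    ℘[L] z ≠ ℘[L] b := by
  intro heq
  set f : ℂ → ℂ := fun w ↦ ℘[L] w - ℘[L] b
  have hf : AnalyticAt ℂ f z := (L.analyticAt_weierstrassP hz).sub analyticAt_const
  set Z : ℂ → ℂ := fun w ↦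
    L.weierstrassZeta (w + b) + L.weierstrassZeta (w - b) - 2 * L.weierstrassZeta w
  have hZ : AnalyticAt ℂ Z z := by
    have a1 := L.analyticAt_weierstrassZeta hz
    have a2 : AnalyticAt ℂ (fun w ↦ L.weierstrassZeta (w + b)) z :=
      L.analyticAt_weierstrassZeta_add hadd
    have a3 : AnalyticAt ℂ (fun w ↦ L.weierstrassZeta (w - b)) z :=
      L.analyticAt_weierstrassZeta_sub hsub
    fun_prop
  have hode : deriv f =ᶠ[𝓝 z] Z * f := by
    have hopen : ∀ c, z + c ∉ L.lattice → ∀ᶠ w in 𝓝 z, w + c ∉ L.lattice := fun c hc ↦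
      ((continuous_id.add continuous_const).tendsto z).eventually
        (L.isClosed_lattice.isOpen_compl.mem_nhds hc)
    filter_upwards [hopen 0 (by simpa using hz), hopen b hadd,
      hopen (-b) (by simpa [← sub_eq_add_neg] using hsub)] with w h1 h2 h3
    rw [← sub_eq_add_neg] at h3
    rw [add_zero] at h1
    rw [Pi.mul_apply, L.weierstrassZeta_add_add_weierstrassZeta_sub h1 hb h2 h3,
      ← deriv_weierstrassP]
    exact deriv_sub_const _
  have hfz : f z = 0 := sub_eq_zero.mpr heq
  have horder : analyticOrderAt (deriv f) z + 1 = analyticOrderAt f z := by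
    simpa [hfz] using hf.analyticOrderAt_deriv_add_one
  rw [analyticOrderAt_congr hode, analyticOrderAt_mul hZ hf] at horder
  have htop : analyticOrderAt f z = ⊤ := by
    by_contra hne
    obtain ⟨n, hn⟩ := ENat.ne_top_iff_exists.mp hne
    rw [← hn] at horder
    cases h : analyticOrderAt Z z with
    | top => simp [h] at horder
    | coe m =>
      rw [h] at horder
      norm_cast at horder
      omega
  refine L.not_eventually_weierstrassP_eq (℘[L] b) hz ?_
  filter_upwards [analyticOrderAt_eq_top.mp htop] with w hw
  exact sub_eq_zero.mp hw

end PeriodPair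

/-- The pair of periods `1, τ`. -/
def periodPairOfTau (τ : ℂ) (hτ : 0 < τ.im) : PeriodPair where
  ω₁ := 1
  ω₂ := τ
  indep := by
    rw [LinearIndependent.pair_iff]
    intro s t h
    have him : t * τ.im = 0 := by simpa using congrArg Complex.im h
    have ht : t = 0 := (mul_eq_zero.mp him).resolve_right hτ.ne'
    subst ht
    simpa using h

lemma mem_Lam_iff {τ : ℂ} (hτ : 0 < τ.im) {z : ℂ} :
    z ∈ Lam τ ↔ z ∈ (periodPairOfTau τ hτ).lattice := by
  rw [PeriodPair.mem_lattice]
  simp [Lam, periodPairOfTau, eq_comm]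

lemma tsum_Lam' {τ : ℂ} (hτ : 0 < τ.im) (f : ℂ → ℂ) :
    ∑' ω : Lam' τ, f ω =
      ∑' l : (periodPairOfTau τ hτ).lattice, if l.1 = 0 then 0 else f l := by
  let i : Lam' τ → (periodPairOfTau τ hτ).lattice := fun ω ↦ ⟨ω, (mem_Lam_iff hτ).mp ω.2.1⟩
  have hi : Function.Injective i := fun a b h ↦ by
    have : (i a).1 = (i b).1 := by rw [h]
    exact Subtype.ext this
  rw [← hi.tsum_eq (f := fun l : (periodPairOfTau τ hτ).lattice ↦ if l.1 = 0 then 0 else f l)]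
  · exact tsum_congr fun ω ↦ (if_neg ω.2.2).symm
  · intro l hl
    have hl0 : l.1 ≠ 0 := fun h ↦ hl (by simp [h])
    exact ⟨⟨l, (mem_Lam_iff hτ).mpr l.2, hl0⟩, rfl⟩

lemma wzeta_eq {τ : ℂ} (hτ : 0 < τ.im) : wzeta τ = (periodPairOfTau τ hτ).weierstrassZeta := by
  ext z
  exact congrArg (1 / z + ·) (tsum_Lam' hτ fun l ↦ 1 / (z - l) + 1 / l + z / l ^ 2)

lemma wp_eq {τ : ℂ} (hτ : 0 < τ.im) : wp τ = (periodPairOfTau τ hτ).weierstrassP := by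
  ext z
  rw [PeriodPair.weierstrassP_eq_except_zero]
  exact congrArg (1 / z ^ 2 + ·) (tsum_Lam' hτ fun l ↦ 1 / (z - l) ^ 2 - 1 / l ^ 2)

lemma wpd_eq {τ : ℂ} (hτ : 0 < τ.im) : wpd τ = (periodPairOfTau τ hτ).derivWeierstrassP := by
  rw [wpd, wp_eq hτ, PeriodPair.deriv_weierstrassP]

/-- If `φ = 1 / (z - a) + r` with `r` analytic at `a`, then `φ' + φ²` has at most a simple pole
at `a`, with residue `2 r(a)`. -/
lemma tendsto_sub_mul_riccati {φ r q : ℂ → ℂ} {a : ℂ} (hr : AnalyticAt ℂ r a)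
    (hφ : ∀ᶠ z in 𝓝[≠] a, φ z = 1 / (z - a) + r z) (hq : ContinuousAt q a) :
    Tendsto (fun z ↦ (z - a) * (deriv φ z + φ z ^ 2 - q z)) (𝓝[≠] a) (𝓝 (2 * r a)) := by
  have hc : ContinuousAt (fun z ↦ (z - a) * (deriv r z + r z ^ 2 - q z) + 2 * r z) a := by
    have := hr.continuousAt
    have := hr.deriv.continuousAt
    fun_prop
  have hlim : Tendsto (fun z ↦ (z - a) * (deriv r z + r z ^ 2 - q z) + 2 * r z) (𝓝[≠] a)
      (𝓝 (2 * r a)) := by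
    simpa using hc.tendsto.mono_left nhdsWithin_le_nhds
  refine hlim.congr' ?_
  filter_upwards [eventually_eventually_nhdsWithin.mpr hφ, hφ, self_mem_nhdsWithin,
    hr.eventually_analyticAt.filter_mono nhdsWithin_le_nhds] with z hev hz hza hrz
  have hza' : z - a ≠ 0 := sub_ne_zero.mpr hza
  rw [isOpen_compl_singleton.nhdsWithin_eq hza] at hev
  have hd : HasDerivAt (fun z ↦ 1 / (z - a) + r z) (-1 / (z - a) ^ 2 + deriv r z) z := by
    simpa using! (((hasDerivAt_id z).sub_const a).inv hza').add
      hrz.differentiableAt.hasDerivAt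
  rw [(hd.congr_of_eventuallyEq hev).deriv, hz]
  field_simp
  ring

open scoped PeriodPair

/-- if `c = ζ(a₁)+ζ(a₂)`, then `g` has at most a simple pole at
`z = a₁` with the stated residue. -/
theorem stmt_10 (τ p a₁ a₂ c A : ℂ) (hτ : 0 < τ.im) (hp : 2 * p ∉ Lam τ)
    (h12 : a₁ - a₂ ∉ Lam τ) (h12' : a₁ + a₂ ∉ Lam τ)
    (ha₁ : a₁ ∉ Sset τ p) (ha₂ : a₂ ∉ Sset τ p)
    (hc : c = wzeta τ a₁ + wzeta τ a₂) :
    Tendsto (fun z => (z - a₁) * gfun τ p a₁ a₂ c A z) (𝓝[≠] a₁)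
      (𝓝 ((wpd τ a₁ * (wp τ p - wp τ a₂) + wpd τ a₂ * (wp τ p - wp τ a₁)) /
            ((wp τ p - wp τ a₁) * (wp τ a₁ - wp τ a₂)))) := by
  have hmem : ∀ z, z ∈ Lam τ ↔ z ∈ (periodPairOfTau τ hτ).lattice := fun z ↦ mem_Lam_iff hτ
  simp only [Sset, Set.mem_union, Set.mem_ofPred_eq, not_or, hmem] at ha₁ ha₂
  rw [hmem] at hp h12 h12'
  rw [wzeta_eq hτ] at hc
  rw [wpd_eq hτ, wp_eq hτ]
  obtain ⟨⟨h1, h1p⟩, h1p'⟩ := ha₁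
  obtain ⟨⟨h2, -⟩, -⟩ := ha₂
  set L := periodPairOfTau τ hτ
  have hp0 : p ∉ L.lattice := fun h ↦ hp (by rw [two_mul]; exact add_mem h h)
  have e1 := L.weierstrassZeta_add_add_weierstrassZeta_sub h1 hp0 h1p' h1p
  have e2 := L.weierstrassZeta_add_add_weierstrassZeta_sub h1 h2 h12' h12
  have e3 := L.weierstrassZeta_add_add_weierstrassZeta_sub h2 h1 (by rwa [add_comm])
    (by rwa [← L.lattice.neg_mem_iff, neg_sub])
  rw [add_comm a₂ a₁, ← neg_sub a₁ a₂, L.weierstrassZeta_neg] at e3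
  have n1 := sub_ne_zero.mpr (L.weierstrassP_ne_weierstrassP h1 hp0 h1p' h1p)
  have n2 := sub_ne_zero.mpr (L.weierstrassP_ne_weierstrassP h1 h2 h12' h12)
  have z1 := L.analyticAt_weierstrassZeta h1
  have z2 := L.analyticAt_weierstrassZeta_sub h12
  have z3 := L.analyticAt_weierstrassZeta_add h1p'
  have z4 := L.analyticAt_weierstrassZeta_sub h1p
  set r : ℂ → ℂ := fun z ↦ c + L.weierstrassZetaRegular (z - a₁) + L.weierstrassZeta (z - a₂)
    - L.weierstrassZeta z - 1 / 2 * (L.weierstrassZeta (z + p) + L.weierstrassZeta (z - p))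
    with hr_def
  have hr : AnalyticAt ℂ r a₁ := by
    have : AnalyticAt ℂ (fun z ↦ L.weierstrassZetaRegular (z - a₁)) a₁ :=
      AnalyticAt.comp (g := L.weierstrassZetaRegular) (f := fun z ↦ z - a₁)
        (by simpa using L.analyticAt_weierstrassZetaRegular) (by fun_prop)
    fun_prop
  have hφ : ∀ z, phiac τ p a₁ a₂ c z = 1 / (z - a₁) + r z := fun z ↦ by
    rw [phiac, wzeta_eq hτ, PeriodPair.weierstrassZeta]
    simp only [hr_def]
    ring
  have hq : ContinuousAt (qpot τ p A) a₁ := by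
    have p1 := (L.analyticAt_weierstrassP h1).continuousAt
    have p2 : ContinuousAt (fun z ↦ ℘[L] (z + p)) a₁ :=
      ContinuousAt.comp (f := fun z ↦ z + p) (L.analyticAt_weierstrassP h1p').continuousAt
        (by fun_prop)
    have p3 : ContinuousAt (fun z ↦ ℘[L] (z - p)) a₁ :=
      ContinuousAt.comp (f := fun z ↦ z - p) (L.analyticAt_weierstrassP h1p).continuousAt
        (by fun_prop)
    have := z3.continuousAt
    have := z4.continuousAt
    unfold qpot
    rw [wp_eq hτ, wzeta_eq hτ]
    fun_prop
  convert! tendsto_sub_mul_riccati hr (.of_forall hφ) hq using 2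
  have n1' : ℘[L] p - ℘[L] a₁ ≠ 0 := by rwa [← neg_ne_zero, neg_sub]
  rw [div_eq_iff (mul_ne_zero n1' n2)]
  simp only [hr_def, sub_self, PeriodPair.weierstrassZetaRegular_zero, hc]
  linear_combination -(℘[L] a₁ - ℘[L] a₂) * e1 - (℘[L] p - ℘[L] a₁) * (e2 + e3)
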